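/- Let k be an algebraically closed field of characteristic zero, A a finitely generated commutative k-algebra, G a finite group acting on A by k-algebra automorphisms, and M a finitely generated G-equivariant A-module. Then M descends to Spec A^G if and only if for every maximal ideal m of A the stabilizer G_m acts trivially (i.e. fixes every element) on M ⊗_A A/m and on Tor_1^A(M, A/m). -/

import Mathlib

/-!
STATEMENT 1 (Theorem "firstprop", affine finite-group case, conditions
(1) ⟺ (3)): for an algebraically closed field `k` of characteristic zero,
a finitely generated commutative `k`-algebra `A`, a finite group `G` acting on
`A` by `k`-algebra automorphisms, and a finitely generated `G`-equivariant
`A`-module `M`, the module `M` descends to `Spec Aᴳ` if and only if for every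
maximal ideal `m` of `A` the stabilizer `G_m` acts trivially (fixes every
element) on `M ⊗[A] A/m` and on `Tor₁ᴬ(M, A/m)`.

Conventions used below:
* The fiber `M ⊗[A] A/m` is realized as `M/mM`; "`g` fixes the class of `y`"
  becomes `g • y - y ∈ m • ⊤`.
* `Tor₁ᴬ(M, A/m)` is realized as the kernel of the multiplication map
  `m ⊗[A] M → M` (tensor `0 → m → A → A/m → 0` with `M`); the action of a
  stabilizer element `g ∈ G_m` on it is `torSmul`.
-/

open TensorProduct

universe u v

/-- The invariant subalgebra `Aᴳ` of the `G`-action on the `k`-algebra `A`. -/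
def invAlg (k : Type*) (A : Type u) (G : Type*) [CommSemiring k] [CommRing A]
    [Algebra k A] [Group G] [MulSemiringAction G A] [SMulCommClass G k A] :
    Subalgebra k A where
  carrier := {a | ∀ g : G, g • a = a}
  mul_mem' := fun ha hb g => by rw [smul_mul', ha g, hb g]
  add_mem' := fun ha hb g => by rw [smul_add, ha g, hb g]
  algebraMap_mem' := fun c g => by
    rw [Algebra.algebraMap_eq_smul_one, smul_comm, smul_one]

/-- A `G`-equivariant `A`-module `M` *descends to `Spec Aᴳ`* if there are an
`Aᴳ`-module `Q` and a `G`-equivariant `A`-linear isomorphism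
`A ⊗[Aᴳ] Q ≃ M`, where `G` acts on `A ⊗[Aᴳ] Q` through the factor `A`. -/
def Descends (k : Type*) (A : Type u) (G : Type*) [Field k] [CommRing A]
    [Algebra k A] [Group G] [MulSemiringAction G A] [SMulCommClass G k A]
    (M : Type v) [AddCommGroup M] [Module A M] [DistribMulAction G M] : Prop :=
  ∃ (Q : Type v) (_ : AddCommGroup Q) (_ : Module (invAlg k A G) Q)
    (e : (A ⊗[invAlg k A G] Q) ≃ₗ[A] M),
      ∀ (g : G) (a : A) (q : Q), e ((g • a) ⊗ₜ q) = g • e (a ⊗ₜ q)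

/-- The multiplication map `m ⊗[A] M →ₗ[A] M`.  Its kernel is the standard
model for `Tor₁ᴬ(M, A/m)` (tensor the exact sequence `0 → m → A → A/m → 0`
with `M` and use `Tor₁ᴬ(M, A) = 0`). -/
noncomputable def torMul (A : Type u) [CommRing A] (M : Type v) [AddCommGroup M]
    [Module A M] (m : Ideal A) : (m ⊗[A] M) →ₗ[A] M :=
  TensorProduct.lift ((LinearMap.lsmul A M).comp m.subtype)

/-- The additive (semilinear) endomorphism of `m ⊗[A] M` induced by a ring
endomorphism `σ` of `A` preserving `m` together with a `σ`-semilinear additive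
endomorphism `τ` of `M`; for `σ`, `τ` given by the action of a stabilizer
element `g ∈ G_m` this is the action of `g` on `m ⊗[A] M`, i.e. on
`Tor₁ᴬ(M, A/m)` by functoriality. -/
noncomputable def torSmul {A : Type u} [CommRing A] {M : Type v} [AddCommGroup M]
    [Module A M] (σ : A →+* A) (τ : M →+ M)
    (hτ : ∀ (a : A) (x : M), τ (a • x) = σ a • τ x)
    (m : Ideal A) (hm : ∀ a ∈ m, σ a ∈ m) :
    (m ⊗[A] M) →+ (m ⊗[A] M) :=
  TensorProduct.liftAddHom
    { toFun := fun x =>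
        { toFun := fun y => (⟨σ (x : A), hm _ x.2⟩ : m) ⊗ₜ[A] (τ y)
          map_zero' := by simp
          map_add' := fun y z => by simp [TensorProduct.tmul_add] }
      map_zero' := by
        have h : (⟨σ ((0 : m) : A), hm _ (0 : m).2⟩ : m) = 0 := Subtype.ext (by simp)
        ext y
        simp only [AddMonoidHom.coe_mk, ZeroHom.coe_mk, AddMonoidHom.zero_apply, h,
          TensorProduct.zero_tmul]
      map_add' := fun x x' => by
        have h : (⟨σ ((x + x' : m) : A), hm _ (x + x').2⟩ : m)
            = ⟨σ (x : A), hm _ x.2⟩ + ⟨σ (x' : A), hm _ x'.2⟩ := Subtype.ext (by simp)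
        ext y
        simp only [AddMonoidHom.coe_mk, ZeroHom.coe_mk, AddMonoidHom.add_apply, h,
          TensorProduct.add_tmul] }
    (fun a x y => by
      have h1 : (⟨σ ((a • x : m) : A), hm _ (a • x).2⟩ : m)
          = σ a • (⟨σ (x : A), hm _ x.2⟩ : m) :=
        Subtype.ext (by simp [smul_eq_mul, map_mul])
      simp only [AddMonoidHom.coe_mk, ZeroHom.coe_mk]
      rw [h1, TensorProduct.smul_tmul, hτ])

section helpers

theorem aux_residue (k : Type*) [Field k] [IsAlgClosed k]
    (A : Type u) [CommRing A] [Algebra k A] [Algebra.FiniteType k A]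
    (m : Ideal A) (hm : m.IsMaximal) (a : A) : ∃ c : k, a - algebraMap k A c ∈ m := by
  let : Field (A ⧸ m) := Ideal.Quotient.field m
  have : Algebra.FiniteType k (A ⧸ m) :=
    Algebra.FiniteType.of_surjective (Ideal.Quotient.mkₐ k m) (Ideal.Quotient.mkₐ_surjective k m)
  have : Module.Finite k (A ⧸ m) := finite_of_finite_type_of_isJacobsonRing k (A ⧸ m)
  obtain ⟨c, hc⟩ := (IsAlgClosed.algebraMap_bijective_of_isIntegral (k := k) (K := A ⧸ m)).2
    (Ideal.Quotient.mk m a)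
  refine ⟨c, ?_⟩
  rw [← Ideal.Quotient.eq, ← hc]
  rfl

theorem aux_smul_algebraMap (k : Type*) [Field k] (A : Type u) [CommRing A] [Algebra k A]
    (G : Type*) [Group G] [MulSemiringAction G A] [SMulCommClass G k A] (g : G) (c : k) :
    g • algebraMap k A c = algebraMap k A c := by
  rw [Algebra.algebraMap_eq_smul_one, smul_comm, smul_one]

theorem aux_smul_sub (k : Type*) [Field k] [IsAlgClosed k]
    (A : Type u) [CommRing A] [Algebra k A] [Algebra.FiniteType k A]
    (G : Type*) [Group G] [MulSemiringAction G A] [SMulCommClass G k A]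
    (m : Ideal A) (hm : m.IsMaximal) (g : G) (hg : ∀ a : A, g • a ∈ m ↔ a ∈ m) (a : A) :
    g • a - a ∈ m := by
  obtain ⟨c, hc⟩ := aux_residue k A m hm a
  have h1 := (hg _).2 hc
  rw [smul_sub, aux_smul_algebraMap] at h1
  have := m.sub_mem h1 hc
  simpa using this

theorem aux_select (A : Type u) [CommRing A]
    (G : Type*) [Group G] [Finite G] [MulSemiringAction G A]
    (m : Ideal A) (hm : m.IsMaximal) :
    ∃ a : A, a - 1 ∈ m ∧ ∀ g : G, ¬ (∀ a : A, g • a ∈ m ↔ a ∈ m) → g • a ∈ m := by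
  classical
  have := Fintype.ofFinite G
  have key : ∀ g : G, ∃ b : A, b - 1 ∈ m ∧ (¬ (∀ a : A, g • a ∈ m ↔ a ∈ m) → g • b ∈ m) := by
    intro g
    by_cases hg : ∀ a : A, g • a ∈ m ↔ a ∈ m
    · exact ⟨1, by simp, fun h => absurd hg h⟩
    · let σ : A ≃+* A := MulSemiringAction.toRingEquiv G A g
      have hmax : (m.comap (σ : A →+* A)).IsMaximal := Ideal.comap_isMaximal_of_equiv σ
      have hne : m.comap (σ : A →+* A) ≠ m := by
        intro h
        apply hg
        intro a
        have : a ∈ m.comap (σ : A →+* A) ↔ a ∈ m := by rw [h]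
        exact this
      have hc := Ideal.IsMaximal.coprime_of_ne hmax hm hne
      have h1 : (1 : A) ∈ m.comap (σ : A →+* A) ⊔ m := by rw [hc]; trivial
      obtain ⟨b, hb, c, hcm, hbc⟩ := Submodule.mem_sup.1 h1
      refine ⟨b, ?_, fun _ => hb⟩
      have : b - 1 = -c := by rw [← hbc]; ring
      rw [this]
      exact m.neg_mem hcm
  choose b hb1 hb2 using key
  refine ⟨∏ g, b g, ?_, ?_⟩
  · rw [← Ideal.Quotient.eq, map_prod, map_one]
    apply Finset.prod_eq_one
    intro g _
    rw [← map_one (Ideal.Quotient.mk m), Ideal.Quotient.eq]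
    exact hb1 g
  · intro g hg
    have : g • ∏ h, b h = (g • b g) * (g • ∏ h ∈ Finset.univ.erase g, b h) := by
      rw [← smul_mul', Finset.mul_prod_erase _ _ (Finset.mem_univ g)]
    rw [this]
    exact m.mul_mem_right _ (hb2 g hg)

/-- a stable f.g. submodule whose fibers have trivial stabilizer action is
generated by invariants -/
theorem aux_gen (k : Type*) [Field k] [CharZero k]
    (A : Type u) [CommRing A] [Algebra k A]
    (G : Type*) [Group G] [Finite G] [MulSemiringAction G A] [SMulCommClass G k A]
    (M : Type v) [AddCommGroup M] [Module A M] [DistribMulAction G M]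
    (hGM : ∀ (g : G) (a : A) (x : M), g • (a • x) = (g • a) • (g • x))
    (N : Submodule A M) (hN : N.FG) (hst : ∀ (g : G), ∀ x ∈ N, g • x ∈ N)
    (hfib : ∀ m : Ideal A, m.IsMaximal → ∀ y ∈ N, ∀ g : G, (∀ a : A, g • a ∈ m ↔ a ∈ m) →
      g • y - y ∈ m • N) :
    N ≤ Submodule.span A {x | x ∈ N ∧ ∀ g : G, g • x = x} := by
  classical
  have := Fintype.ofFinite G
  set S := Submodule.span A {x | x ∈ N ∧ ∀ g : G, g • x = x} with hS
  have step : ∀ m : Ideal A, m.IsMaximal → N ≤ S ⊔ m • N := by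
    intro m hm y hy
    obtain ⟨a, ha1, ha2⟩ := aux_select A G m hm
    set n : ℕ := (Finset.univ.filter (fun g : G => ∀ a : A, g • a ∈ m ↔ a ∈ m)).card with hn
    have hn0 : (n : k) ≠ 0 := by
      rw [Nat.cast_ne_zero, hn, Finset.card_ne_zero]
      exact ⟨1, by simp⟩
    set c : A := algebraMap k A ((n : k)⁻¹) with hc
    have hcn : (n : A) * c = 1 := by
      rw [hc, ← map_natCast (algebraMap k A) n, ← map_mul, mul_inv_cancel₀ hn0, map_one]
    let x : M := ∑ g : G, g • (a • y)
    have hxN : x ∈ N := N.sum_mem fun g _ => hst g _ (N.smul_mem _ hy)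
    have hxinv : ∀ g : G, g • x = x := by
      intro g
      simp only [x, Finset.smul_sum, smul_smul g]
      exact Fintype.sum_equiv (Equiv.mulLeft g) _ _ (fun h => by simp)
    have hxS : x ∈ S := Submodule.subset_span ⟨hxN, hxinv⟩
    have hxy : x - (n : A) • y ∈ m • N := by
      have h1 : (n : A) • y = ∑ g : G, if (∀ a : A, g • a ∈ m ↔ a ∈ m) then y else 0 := by
        rw [← Finset.sum_filter, Finset.sum_const, Nat.cast_smul_eq_nsmul]
      rw [h1, ← Finset.sum_sub_distrib]
      refine Submodule.sum_mem _ fun g _ => ?_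
      split_ifs with hg
      · have h2 : g • a • y - y = (g • a - 1) • (g • y) + (g • y - y) := by
          rw [hGM, sub_smul, one_smul]; abel
        rw [h2]
        refine Submodule.add_mem _ (Submodule.smul_mem_smul ?_ (hst g y hy)) (hfib m hm y hy g hg)
        have := (hg _).2 ha1
        rwa [smul_sub, smul_one] at this
      · rw [sub_zero, hGM]
        exact Submodule.smul_mem_smul (ha2 g hg) (hst g y hy)
    have : y = c • x - c • (x - (n : A) • y) := by
      rw [smul_sub, smul_smul, mul_comm, hcn, one_smul]; abel
    rw [this]
    exact Submodule.sub_mem _ (Submodule.mem_sup_left (S.smul_mem _ hxS))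
      (Submodule.mem_sup_right (Submodule.smul_mem _ _ hxy))
  intro y hy
  let I : Ideal A := S.comap (LinearMap.toSpanSingleton A M y)
  have hI : I = ⊤ := by
    by_contra h
    obtain ⟨m, hm, hle⟩ := Ideal.exists_le_maximal I h
    obtain ⟨r, hr1, hr2⟩ := Submodule.exists_sub_one_mem_and_smul_le_of_fg_of_le_sup hN le_rfl
      (step m hm)
    have hrI : r ∈ I := by
      change r • y ∈ S
      exact hr2 (Submodule.smul_mem_pointwise_smul _ _ _ hy)
    apply hm.ne_top
    rw [Ideal.eq_top_iff_one]
    have := m.sub_mem (hle hrI) hr1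
    simpa using this
  have h1 : (1 : A) ∈ I := by rw [hI]; trivial
  have h2 : (1 : A) • y ∈ S := h1
  rwa [one_smul] at h2

theorem aux_torMul_mem (A : Type u) [CommRing A] (M : Type v) [AddCommGroup M]
    [Module A M] (m : Ideal A) (t : m ⊗[A] M) : torMul A M m t ∈ m • (⊤ : Submodule A M) := by
  induction t with
  | zero => simp
  | add x y hx hy => rw [map_add]; exact Submodule.add_mem _ hx hy
  | tmul x y => exact Submodule.smul_mem_smul x.2 trivial

theorem aux_torMul_surj (A : Type u) [CommRing A] (M : Type v) [AddCommGroup M]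
    [Module A M] (m : Ideal A) (z : M) (hz : z ∈ m • (⊤ : Submodule A M)) :
    ∃ t : m ⊗[A] M, torMul A M m t = z := by
  have : m • (⊤ : Submodule A M) ≤ LinearMap.range (torMul A M m) := by
    rw [Submodule.smul_le]
    intro r hr x _
    exact ⟨(⟨r, hr⟩ : m) ⊗ₜ x, rfl⟩
  exact this hz

theorem aux_torMul_lTensor (A : Type u) [CommRing A] (M : Type*) [AddCommGroup M]
    [Module A M] (N : Type*) [AddCommGroup N] [Module A N] (p : N →ₗ[A] M) (m : Ideal A)
    (t : m ⊗[A] N) : torMul A M m (LinearMap.lTensor m p t) = p (torMul A N m t) := by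
  induction t with
  | zero => simp
  | add x y hx hy => simp only [map_add, hx, hy]
  | tmul x y => simp [torMul]

theorem aux_torMul_torSmul {A : Type u} [CommRing A] {M : Type*} [AddCommGroup M]
    [Module A M] (σ : A →+* A) (τ : M →+ M)
    (hτ : ∀ (a : A) (x : M), τ (a • x) = σ a • τ x)
    (m : Ideal A) (hm : ∀ a ∈ m, σ a ∈ m) (t : m ⊗[A] M) :
    torMul A M m (torSmul σ τ hτ m hm t) = τ (torMul A M m t) := by
  induction t with
  | zero => simp
  | add x y hx hy => simp only [map_add, hx, hy]
  | tmul x y => simp [torMul, torSmul, hτ]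

theorem aux_lTensor_torSmul {A : Type u} [CommRing A] {M : Type*} [AddCommGroup M]
    [Module A M] {N : Type*} [AddCommGroup N] [Module A N]
    (σ : A →+* A) (τ : M →+ M)
    (hτ : ∀ (a : A) (x : M), τ (a • x) = σ a • τ x)
    (τ' : N →+ N) (hτ' : ∀ (a : A) (x : N), τ' (a • x) = σ a • τ' x)
    (p : N →ₗ[A] M) (hp : ∀ x, p (τ' x) = τ (p x))
    (m : Ideal A) (hm : ∀ a ∈ m, σ a ∈ m) (t : m ⊗[A] N) :
    LinearMap.lTensor m p (torSmul σ τ' hτ' m hm t)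
      = torSmul σ τ hτ m hm (LinearMap.lTensor m p t) := by
  induction t with
  | zero => simp
  | add x y hx hy => simp only [map_add, hx, hy]
  | tmul x y => simp [torSmul, hp]

/-- a unipotent (mod `P`) element of finite order acts trivially mod `P` -/
theorem aux_unip (k : Type*) [Field k] [CharZero k]
    (A : Type u) [CommRing A] [Algebra k A]
    (G : Type*) [Group G] [Finite G]
    (M : Type*) [AddCommGroup M] [Module A M] [DistribMulAction G M]
    (P : Submodule A M) (g : G) (hP : ∀ x ∈ P, g • x ∈ P) (y : M)
    (h : g • (g • y - y) - (g • y - y) ∈ P) : g • y - y ∈ P := by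
  have key : ∀ j : ℕ, g ^ j • y - y - j • (g • y - y) ∈ P := by
    intro j
    induction j with
    | zero => simp
    | succ j ih =>
      have h1 := hP _ ih
      have h3 := P.smul_of_tower_mem j h
      have : g ^ (j + 1) • y - y - (j + 1) • (g • y - y) =
          g • (g ^ j • y - y - j • (g • y - y)) + j • (g • (g • y - y) - (g • y - y)) := by
        rw [pow_succ', mul_smul, smul_sub g, smul_sub g, smul_comm g j, add_smul, one_smul,
          smul_sub j (g • (g • y - y))]
        abel
      rw [this]
      exact P.add_mem h1 h3
  have h1 := key (Nat.card G)
  rw [pow_card_eq_one', one_smul, sub_self, zero_sub] at h1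
  have h2 := P.neg_mem h1
  rw [neg_neg, ← Nat.cast_smul_eq_nsmul A] at h2
  have h3 := P.smul_mem (algebraMap k A ((Nat.card G : k)⁻¹)) h2
  rwa [smul_smul, ← map_natCast (algebraMap k A), ← map_mul, inv_mul_cancel₀, map_one,
    one_smul] at h3
  exact Nat.cast_ne_zero.2 Nat.card_pos.ne'

theorem aux_forward
    (k : Type*) [Field k] [CharZero k] [IsAlgClosed k]
    (A : Type u) [CommRing A] [Algebra k A] [Algebra.FiniteType k A]
    (G : Type*) [Group G] [Finite G] [MulSemiringAction G A] [SMulCommClass G k A]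
    (M : Type v) [AddCommGroup M] [Module A M]
    [DistribMulAction G M]
    (hGM : ∀ (g : G) (a : A) (x : M), g • (a • x) = (g • a) • (g • x))
    (hD : Descends k A G M) (m : Ideal A) (hm : m.IsMaximal) (g : G)
    (hg : ∀ a : A, g • a ∈ m ↔ a ∈ m) :
    (∀ y : M, g • y - y ∈ m • (⊤ : Submodule A M)) ∧
    (∀ t : m ⊗[A] M, torMul A M m t = 0 →
            torSmul (MulSemiringAction.toRingHom G A g)
              (DistribMulAction.toAddMonoidHom M g)
              (fun a x => hGM g a x) m (fun a ha => (hg a).mpr ha) t = t) := by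
  obtain ⟨Q, _, _, e, he⟩ := hD
  have hsub := aux_smul_sub k A G m hm g hg
  have het : ∀ (a : A) (q : Q), e (a ⊗ₜ q) = a • e (1 ⊗ₜ q) := by
    intro a q
    rw [← map_smul, TensorProduct.smul_tmul', smul_eq_mul, mul_one]
  have hinv : ∀ (g : G) (q : Q), g • e (1 ⊗ₜ q) = e (1 ⊗ₜ q) := by
    intro g q
    rw [← he, smul_one]
  refine ⟨?_, ?_⟩
  · intro y
    obtain ⟨s, rfl⟩ := e.surjective y
    induction s with
    | zero => simp
    | add x y hx hy =>
      rw [map_add, smul_add, add_sub_add_comm]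
      exact Submodule.add_mem _ hx hy
    | tmul a q =>
      rw [← he, ← map_sub, ← TensorProduct.sub_tmul, het]
      exact Submodule.smul_mem_smul (hsub a) trivial
  · -- the invariant functions
    let φ : (m ⊗[invAlg k A G] Q) →+ (m ⊗[A] M) :=
      TensorProduct.liftAddHom
        { toFun := fun x =>
            { toFun := fun q => x ⊗ₜ[A] e (1 ⊗ₜ q)
              map_zero' := by simp
              map_add' := fun q q' => by simp [TensorProduct.tmul_add] }
          map_zero' := by ext q; simp
          map_add' := fun x x' => by ext q; simp [TensorProduct.add_tmul] }
        (fun b x q => by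
          have h1 : b • x = (b : A) • x := rfl
          have h2 : (1 : A) ⊗ₜ[invAlg k A G] (b • q) = (b : A) ⊗ₜ[invAlg k A G] q := by
            rw [← TensorProduct.smul_tmul]
            congr 1
            change (b : A) * 1 = b
            rw [mul_one]
          simp only [AddMonoidHom.coe_mk, ZeroHom.coe_mk]
          rw [h1, h2, het (b : A), TensorProduct.smul_tmul])
    have hφ : ∀ (x : m) (q : Q), φ (x ⊗ₜ q) = x ⊗ₜ[A] e (1 ⊗ₜ q) := fun x q => rfl
    have hφs : ∀ t : m ⊗[A] M, ∃ s, φ s = t := by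
      intro t
      induction t with
      | zero => exact ⟨0, map_zero _⟩
      | add x y hx hy =>
        obtain ⟨s, rfl⟩ := hx
        obtain ⟨s', rfl⟩ := hy
        exact ⟨s + s', map_add _ _ _⟩
      | tmul x y =>
        obtain ⟨w, rfl⟩ := e.surjective y
        induction w with
        | zero => exact ⟨0, by simp⟩
        | add u w hu hw =>
          obtain ⟨s, hs⟩ := hu
          obtain ⟨s', hs'⟩ := hw
          exact ⟨s + s', by rw [map_add, hs, hs', map_add, TensorProduct.tmul_add]⟩
        | tmul a q =>
          exact ⟨(a • x) ⊗ₜ q, by rw [hφ, het a, TensorProduct.smul_tmul]⟩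
    let ι : m →ₗ[invAlg k A G] A := m.subtype.restrictScalars (invAlg k A G)
    let δ : A →ₗ[invAlg k A G] m :=
      { toFun := fun a => ⟨g • a - a, hsub a⟩
        map_add' := fun a b => Subtype.ext (by
          change g • (a + b) - (a + b) = (g • a - a) + (g • b - b)
          rw [smul_add]; abel)
        map_smul' := fun b a => Subtype.ext (by
          change g • ((b : A) * a) - (b : A) * a = (b : A) * (g • a - a)
          rw [smul_mul', b.2 g]; ring) }
    have hmul : ∀ s, torMul A M m (φ s) = e (LinearMap.rTensor Q ι s) := by
      intro s
      induction s with
      | zero => simp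
      | add x y hx hy => simp only [map_add, hx, hy]
      | tmul x q =>
        rw [hφ, LinearMap.rTensor_tmul, het (ι x)]
        rfl
    intro t ht
    obtain ⟨s, rfl⟩ := hφs t
    have hs0 : LinearMap.rTensor Q ι s = 0 := by
      rw [hmul] at ht
      exact (LinearEquiv.map_eq_zero_iff e).1 ht
    have hmain : ∀ s, torSmul (MulSemiringAction.toRingHom G A g)
              (DistribMulAction.toAddMonoidHom M g)
              (fun a x => hGM g a x) m (fun a ha => (hg a).mpr ha) (φ s)
        = φ s + φ (LinearMap.rTensor Q δ (LinearMap.rTensor Q ι s)) := by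
      intro s
      induction s with
      | zero => simp
      | add x y hx hy =>
        simp only [map_add, hx, hy]
        abel
      | tmul x q =>
        rw [LinearMap.rTensor_tmul, LinearMap.rTensor_tmul, hφ, hφ, ← TensorProduct.add_tmul]
        have h1 : x + δ (ι x) = (⟨g • (x : A), (hg _).2 x.2⟩ : m) :=
          Subtype.ext (by
            change (x : A) + (g • (x : A) - x) = g • (x : A)
            abel)
        rw [h1]
        change (⟨g • (x : A), (hg _).2 x.2⟩ : m) ⊗ₜ[A] (g • e (1 ⊗ₜ q)) = _
        rw [hinv]
    rw [hmain, hs0, map_zero, map_zero, add_zero]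

/-- the invariants of `M`, as a module over the invariant subalgebra -/
def invMod (k : Type*) (A : Type u) (G : Type*) [Field k] [CommRing A]
    [Algebra k A] [Group G] [MulSemiringAction G A] [SMulCommClass G k A]
    (M : Type v) [AddCommGroup M] [Module A M] [DistribMulAction G M]
    (hGM : ∀ (g : G) (a : A) (x : M), g • (a • x) = (g • a) • (g • x)) :
    Submodule (invAlg k A G) M where
  carrier := {x | ∀ g : G, g • x = x}
  add_mem' := fun ha hb g => by rw [smul_add, ha g, hb g]
  zero_mem' := fun g => smul_zero g
  smul_mem' := fun b x hx g => by
    change g • ((b : A) • x) = (b : A) • x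
    rw [hGM, b.2 g, hx g]

theorem aux_backward
    (k : Type*) [Field k] [CharZero k] [IsAlgClosed k]
    (A : Type u) [CommRing A] [Algebra k A] [Algebra.FiniteType k A]
    (G : Type*) [Group G] [Finite G] [MulSemiringAction G A] [SMulCommClass G k A]
    (M : Type v) [AddCommGroup M] [Module A M] [Module.Finite A M]
    [DistribMulAction G M]
    (hGM : ∀ (g : G) (a : A) (x : M), g • (a • x) = (g • a) • (g • x))
    (H : ∀ m : Ideal A, m.IsMaximal →
        (∀ (y : M) (g : G), (∀ a : A, g • a ∈ m ↔ a ∈ m) →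
            g • y - y ∈ m • (⊤ : Submodule A M)) ∧
        (∀ t : m ⊗[A] M, torMul A M m t = 0 →
          ∀ (g : G) (hg : ∀ a : A, g • a ∈ m ↔ a ∈ m),
            torSmul (MulSemiringAction.toRingHom G A g)
              (DistribMulAction.toAddMonoidHom M g)
              (fun a x => hGM g a x) m (fun a ha => (hg a).mpr ha) t = t)) :
    Descends k A G M := by
  classical
  have := Fintype.ofFinite G
  have : IsNoetherianRing A := Algebra.FiniteType.isNoetherianRing k A
  have hgen : ⊤ ≤ Submodule.span A {x : M | x ∈ (⊤ : Submodule A M) ∧ ∀ g : G, g • x = x} :=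
    aux_gen k A G M hGM ⊤ Module.Finite.fg_top (fun _ _ _ => trivial)
      (fun m hm y _ g hg => (H m hm).1 y g hg)
  have hfg : (Submodule.span A {x : M | x ∈ (⊤ : Submodule A M) ∧ ∀ g : G, g • x = x}).FG := by
    rw [top_le_iff.1 hgen]; exact Module.Finite.fg_top
  obtain ⟨s, hs, hspan⟩ := (Submodule.fg_span_iff_fg_span_finset_subset _).1 hfg
  rw [top_le_iff.1 hgen] at hspan
  have hinv : ∀ (i : s) (g : G), g • (i : M) = i := fun i => (hs i.2).2
  -- the free cover
  let p : (s → A) →ₗ[A] M := Fintype.linearCombination A (fun i : s => (i : M))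
  have hp : ∀ f, p f = ∑ i, f i • (i : M) := fun f => Fintype.linearCombination_apply _ _ _
  have hpsurj : Function.Surjective p := by
    intro x
    have hx : x ∈ Submodule.span A (Set.range (fun i : s => (i : M))) := by
      have : Set.range (fun i : s => (i : M)) = (s : Set M) := Subtype.range_coe
      rw [this, ← hspan]
      trivial
    obtain ⟨c, hc⟩ := (Submodule.mem_span_range_iff_exists_fun A).1 hx
    exact ⟨c, by rw [hp, hc]⟩
  have hpG : ∀ (g : G) f, p (g • f) = g • p f := by
    intro g f
    rw [hp, hp, Finset.smul_sum]
    refine Finset.sum_congr rfl fun i _ => ?_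
    rw [hGM, hinv]
    rfl
  have hGF : ∀ (g : G) (a : A) (x : s → A), g • (a • x) = (g • a) • (g • x) := by
    intro g a x
    ext i
    simp [smul_mul']
  let K := LinearMap.ker p
  have hKst : ∀ (g : G), ∀ x ∈ K, g • x ∈ K := by
    intro g x hx
    rw [LinearMap.mem_ker] at hx ⊢
    rw [hpG, hx, smul_zero]
  have hKfg : K.FG := IsNoetherian.noetherian K
  have hKfib : ∀ m : Ideal A, m.IsMaximal → ∀ y ∈ K, ∀ g : G, (∀ a : A, g • a ∈ m ↔ a ∈ m) →
      g • y - y ∈ m • K := by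
    intro m hm y hy g hg
    have hstab : ∀ x ∈ m • K, g • x ∈ m • K := by
      intro x hx
      induction hx using Submodule.smul_induction_on' with
      | smul r hr n hn =>
        rw [hGF]
        exact Submodule.smul_mem_smul ((hg r).2 hr) (hKst g n hn)
      | add x _ y _ hx hy => rw [smul_add]; exact Submodule.add_mem _ hx hy
    apply aux_unip k A G (s → A) (m • K) g hstab y
    set z := g • y - y with hz
    have hzK : z ∈ K := K.sub_mem (hKst g y hy) hy
    have hzm : z ∈ m • (⊤ : Submodule A (s → A)) := by
      have : z = ∑ i, z i • (Pi.single i (1 : A) : s → A) := pi_eq_sum_univ' z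
      rw [this]
      refine Submodule.sum_mem _ fun i _ => Submodule.smul_mem_smul ?_ trivial
      exact aux_smul_sub k A G m hm g hg (y i)
    obtain ⟨t', ht'⟩ := aux_torMul_surj A (s → A) m z hzm
    have h0 : torMul A M m (LinearMap.lTensor m p t') = 0 := by
      rw [aux_torMul_lTensor, ht']; exact hzK
    have h1 := (H m hm).2 _ h0 g hg
    rw [← aux_lTensor_torSmul (MulSemiringAction.toRingHom G A g)
      (DistribMulAction.toAddMonoidHom M g) (fun a x => hGM g a x)
      (DistribMulAction.toAddMonoidHom (s → A) g) (fun a x => hGF g a x) p (fun x => hpG g x) m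
      (fun a ha => (hg a).mpr ha) t', ← sub_eq_zero, ← map_sub] at h1
    have hex : Function.Exact K.subtype p := LinearMap.exact_subtype_ker_map p
    obtain ⟨u, hu⟩ := (lTensor_exact m hex hpsurj _).1 h1
    have h2 := congrArg (torMul A (s → A) m) hu
    rw [aux_torMul_lTensor, map_sub, ht'] at h2
    have h4 := aux_torMul_torSmul (MulSemiringAction.toRingHom G A g)
      (DistribMulAction.toAddMonoidHom (s → A) g) (fun a x => hGF g a x) m
      (fun a ha => (hg a).mpr ha) t'
    rw [ht'] at h4
    replace h2 := h2.trans (congrArg (fun w => w - z) h4)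
    change _ = g • z - z at h2
    rw [← h2]
    have h3 := Submodule.mem_map_of_mem (f := K.subtype) (aux_torMul_mem A K m u)
    rwa [Submodule.map_smul'', Submodule.map_top, Submodule.range_subtype] at h3
  have hKgen := aux_gen k A G (s → A) hGF K hKfg hKst hKfib
  -- the descended module
  let Q := invMod k A G M hGM
  let x : s → Q := fun i => ⟨i, hinv i⟩
  let E : (A ⊗[invAlg k A G] Q) →ₗ[A] M :=
    TensorProduct.AlgebraTensorModule.lift
      ((LinearMap.lsmul A (Q →ₗ[invAlg k A G] M)).flip Q.subtype)
  have hE : ∀ (a : A) (q : Q), E (a ⊗ₜ q) = a • (q : M) := fun a q => rfl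
  let P : (s → A) →ₗ[A] (A ⊗[invAlg k A G] Q) :=
    Fintype.linearCombination A (fun i : s => (1 : A) ⊗ₜ[invAlg k A G] x i)
  have hP : ∀ f, P f = ∑ i, f i ⊗ₜ[invAlg k A G] x i := by
    intro f
    refine (Fintype.linearCombination_apply _ _ _).trans (Finset.sum_congr rfl fun i _ => ?_)
    rw [TensorProduct.smul_tmul', smul_eq_mul, mul_one]
  have hEP : ∀ f, E (P f) = p f := by
    intro f
    rw [hP, hp, map_sum]
    rfl
  -- moving invariant vectors across
  have hmove : ∀ b : s → invAlg k A G, P (fun i => (b i : A)) = 1 ⊗ₜ (∑ i, b i • x i) := by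
    intro b
    rw [hP, TensorProduct.tmul_sum]
    refine Finset.sum_congr rfl fun i _ => ?_
    rw [← TensorProduct.smul_tmul]
    congr 1
    change (b i : A) = (b i : A) * 1
    rw [mul_one]
  have hcoe : ∀ b : s → invAlg k A G, ((∑ i, b i • x i : Q) : M) = p (fun i => (b i : A)) := by
    intro b
    rw [hp, AddSubmonoidClass.coe_finset_sum]
    rfl
  have hQgen : ∀ q : Q, ∃ b : s → invAlg k A G, q = ∑ i, b i • x i := by
    intro q
    obtain ⟨f, hf⟩ := hpsurj (q : M)
    have hn0 : (Fintype.card G : k) ≠ 0 := Nat.cast_ne_zero.2 Fintype.card_ne_zero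
    let c : A := algebraMap k A ((Fintype.card G : k)⁻¹)
    have hcn : c * (Fintype.card G : A) = 1 := by
      rw [← map_natCast (algebraMap k A) (Fintype.card G), ← map_mul, inv_mul_cancel₀ hn0, map_one]
    let b : s → invAlg k A G := fun i => ⟨c * ∑ g : G, g • f i, by
      intro g
      rw [smul_mul', aux_smul_algebraMap, Finset.smul_sum]
      congr 1
      simp only [smul_smul]
      exact Fintype.sum_equiv (Equiv.mulLeft g) _ _ (fun h => by simp)⟩
    refine ⟨b, Subtype.ext ?_⟩
    rw [hcoe]
    have h1 : (fun i => (b i : A)) = c • ∑ g : G, g • f := by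
      ext i
      simp [b, Finset.sum_apply]
    have h2 : ∀ g : G, g • (q : M) = q := q.2
    rw [h1, map_smul, map_sum]
    simp only [hpG, hf, h2]
    rw [Finset.sum_const, Finset.card_univ, ← Nat.cast_smul_eq_nsmul A, smul_smul, hcn, one_smul]
  have hPsurj : Function.Surjective P := by
    intro w
    induction w with
    | zero => exact ⟨0, map_zero _⟩
    | add u w hu hw =>
      obtain ⟨f, rfl⟩ := hu
      obtain ⟨f', rfl⟩ := hw
      exact ⟨f + f', map_add _ _ _⟩
    | tmul a q =>
      obtain ⟨b, rfl⟩ := hQgen q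
      refine ⟨a • fun i => (b i : A), ?_⟩
      rw [map_smul, hmove, TensorProduct.smul_tmul', smul_eq_mul, mul_one]
  have hKP : K ≤ LinearMap.ker P := by
    refine hKgen.trans (Submodule.span_le.2 ?_)
    rintro f ⟨hfK, hf⟩
    let b : s → invAlg k A G := fun i => ⟨f i, fun g => congrFun (hf g) i⟩
    have h1 := hmove b
    have h2 : (∑ i, b i • x i) = 0 := Subtype.ext ((hcoe b).trans hfK)
    rw [h2, TensorProduct.tmul_zero] at h1
    exact h1
  have hbij : Function.Bijective E := by
    constructor
    · rw [injective_iff_map_eq_zero]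
      intro w hw
      obtain ⟨f, rfl⟩ := hPsurj w
      rw [hEP] at hw
      exact hKP hw
    · intro y
      obtain ⟨f, rfl⟩ := hpsurj y
      exact ⟨P f, hEP f⟩
  refine ⟨Q, inferInstance, inferInstance, LinearEquiv.ofBijective E hbij, ?_⟩
  intro g a q
  have h2 : g • (q : M) = q := q.2 g
  change E _ = g • E _
  rw [hE, hE, hGM, h2]

end helpers

/-- **Descent criterion over an algebraically closed field**: `M` descends to
`Spec Aᴳ` iff for every maximal ideal `m ⊆ A` the stabilizer `G_m` acts
trivially on the fiber `M ⊗[A] A/m` and on `Tor₁ᴬ(M, A/m)`. -/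
theorem descends_iff_stabilizers_act_trivially_on_fiber_and_tor
    (k : Type*) [Field k] [CharZero k] [IsAlgClosed k]
    (A : Type u) [CommRing A] [Algebra k A] [Algebra.FiniteType k A]
    (G : Type*) [Group G] [Finite G] [MulSemiringAction G A] [SMulCommClass G k A]
    (M : Type v) [AddCommGroup M] [Module A M] [Module.Finite A M]
    [DistribMulAction G M]
    (hGM : ∀ (g : G) (a : A) (x : M), g • (a • x) = (g • a) • (g • x)) :
    Descends k A G M ↔
      ∀ m : Ideal A, m.IsMaximal →
        -- `G_m` acts trivially on `M ⊗[A] A/m`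
        (∀ (y : M) (g : G), (∀ a : A, g • a ∈ m ↔ a ∈ m) →
            g • y - y ∈ m • (⊤ : Submodule A M)) ∧
        -- `G_m` acts trivially on `Tor₁ᴬ(M, A/m)`
        (∀ t : m ⊗[A] M, torMul A M m t = 0 →
          ∀ (g : G) (hg : ∀ a : A, g • a ∈ m ↔ a ∈ m),
            torSmul (MulSemiringAction.toRingHom G A g)
              (DistribMulAction.toAddMonoidHom M g)
              (fun a x => hGM g a x) m (fun a ha => (hg a).mpr ha) t = t) := by
  constructor
  · intro hD m hm
    exact ⟨fun y g hg => (aux_forward k A G M hGM hD m hm g hg).1 y,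
      fun t ht g hg => (aux_forward k A G M hGM hD m hm g hg).2 t ht⟩
  · exact aux_backward k A G M hGM
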